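/- Let (M_t)_{t≥0} be a peeling Markov chain started from a state n, and let m be an integer with 0 ≤ m < n. Then the probability that the chain ever visits m, i.e. P(∃ t ≥ 0 with M_t = m), equals 1 − (n)_{m+1} / (n+1/2)_{m+1}, where (x)_{m+1} = x(x−1)···(x−m) = Γ(x+1)/Γ(x−m) is the descending factorial. -/

import Mathlib

open Filter MeasureTheory ProbabilityTheory

/-- `p_{-1,m} = (2m+3)/(3m+3)`, the probability that the peeling step from boundary
size `m` adds a new vertex. -/
noncomputable def pMinusOne (m : ℕ) : ℝ := (2 * (m : ℝ) + 3) / (3 * (m : ℝ) + 3)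

/-- `p_{k,m} = 2 (2k-2)! m!² (2m-2k+1)! / ((k-1)!(k+1)!(m-k)!²(2m+1)!)`, the probability
that the peeling step from boundary size `m` swallows `k` boundary vertices (`1 ≤ k ≤ m`). -/
noncomputable def pStep (k m : ℕ) : ℝ :=
  2 * ((2 * k - 2).factorial : ℝ) * ((m.factorial : ℝ)) ^ 2 *
      ((2 * m - 2 * k + 1).factorial : ℝ) /
    (((k - 1).factorial : ℝ) * ((k + 1).factorial : ℝ) * (((m - k).factorial : ℝ)) ^ 2 *
      ((2 * m + 1).factorial : ℝ))

/-- The one-step transition probability of the peeling Markov chain: from state `m`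
the chain moves to `m+1` with probability `p_{-1,m}`, and to `m-k` with probability
`p_{k,m}` for `1 ≤ k ≤ m`. -/
noncomputable def peelTransition (m j : ℕ) : ℝ :=
  if j = m + 1 then pMinusOne m
  else if j < m then pStep (m - j) m
  else 0

/-- `(M_t)_{t≥0}` is a peeling Markov chain w.r.t. the probability measure `P`:
each `M t` is measurable, and conditionally on any initial trajectory
`(M_0,…,M_t) = (h 0,…,h t)` of positive probability, `M_{t+1} = j` with
probability `peelTransition (h t) j`. -/
def IsPeelingChain {Ω : Type*} [MeasurableSpace Ω] (P : Measure Ω) (M : ℕ → Ω → ℕ) : Prop :=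
  (∀ t, Measurable (M t)) ∧
  ∀ (t : ℕ) (h : ℕ → ℕ),
    P {ω | ∀ i ≤ t, M i ω = h i} ≠ 0 →
    ∀ j : ℕ,
      (P[|{ω | ∀ i ≤ t, M i ω = h i}]) {ω | M (t + 1) ω = j} =
        ENNReal.ofReal (peelTransition (h t) j)

/-- The descending factorial `(x)_k = x(x-1)⋯(x-k+1) = Γ(x+1)/Γ(x-k+1)`. -/
noncomputable def descFact (x : ℝ) (k : ℕ) : ℝ := ∏ i ∈ Finset.range k, (x - i)

/-- `h(r) = (2r+1)!/r!²`. -/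
noncomputable def peelH (r : ℕ) : ℝ := ((2 * r + 1).factorial : ℝ) / ((r.factorial : ℝ)) ^ 2

/-- `w_{i+1}`. -/
noncomputable def peelC (i : ℕ) : ℝ :=
  ((2 * i).factorial : ℝ) / ((i.factorial : ℝ) * ((i + 1).factorial : ℝ))

lemma peelH_pos (r : ℕ) : 0 < peelH r := by unfold peelH; positivity

lemma peelH_succ (r : ℕ) : peelH (r + 1) * (r + 1) = peelH r * (2 * (2 * r + 3)) := by
  unfold peelH
  rw [show 2 * (r + 1) + 1 = (2 * r + 1 + 1) + 1 by ring, Nat.factorial_succ (2 * r + 1 + 1),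
    Nat.factorial_succ (2 * r + 1), Nat.factorial_succ r]
  have := Nat.factorial_pos r
  push_cast
  field_simp
  ring

lemma peelC_succ (r : ℕ) : peelC (r + 1) * (r + 2) = peelC r * (2 * (2 * r + 1)) := by
  unfold peelC
  rw [show 2 * (r + 1) = (2 * r + 1) + 1 by ring, Nat.factorial_succ (2 * r + 1),
    Nat.factorial_succ (2 * r), Nat.factorial_succ (r + 1), Nat.factorial_succ r]
  have := Nat.factorial_pos r
  push_cast
  field_simp
  ring

lemma pStep_eq (i s : ℕ) :
    pStep (i + 1) (i + 1 + s) = 2 * peelC i / (i + 2) * peelH s / peelH (i + 1 + s) := by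
  unfold pStep peelC peelH
  rw [show 2 * (i + 1) - 2 = 2 * i by omega,
    show 2 * (i + 1 + s) - 2 * (i + 1) + 1 = 2 * s + 1 by omega,
    show i + 1 - 1 = i by omega, show i + 1 + s - (i + 1) = s by omega,
    Nat.factorial_succ (i + 1)]
  have := Nat.factorial_pos i
  have := Nat.factorial_pos (i + 1)
  have := Nat.factorial_pos s
  have := Nat.factorial_pos (i + 1 + s)
  push_cast
  field_simp
  ring

lemma pMinusOne_eq (k : ℕ) : pMinusOne k = peelH (k + 1) / (6 * peelH k) := by
  have h1 := peelH_succ k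
  have h2 := peelH_pos k
  unfold pMinusOne
  rw [div_eq_div_iff (by positivity) (by positivity)]
  linear_combination -3 * h1

lemma peel_partial (j s : ℕ) :
    peelH (j + s + 1) / 6 - peelH (j + s)
      + ∑ i ∈ Finset.range j, 2 * peelC i / (i + 2) * peelH (j + s - (i + 1))
    = - (1 / 3) * s / (j + s + 1) * peelC j * peelH s := by
  induction j generalizing s with
  | zero =>
    have h1 := peelH_succ s
    have : peelC 0 = 1 := by simp [peelC]
    simp only [Finset.range_zero, Finset.sum_empty, this, zero_add, Nat.cast_zero]
    field_simp
    linear_combination 3 * h1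
  | succ j ih =>
    have h1 := ih (s + 1)
    have h2 := peelH_succ s
    have h3 := peelC_succ j
    rw [Finset.sum_range_succ]
    rw [show j + (s + 1) = j + 1 + s by ring] at h1
    rw [← add_assoc, h1, show j + 1 + s - (j + 1) = s by omega]
    have h2' : peelH (s + 1) = peelH s * (2 * (2 * s + 3)) / (s + 1) := by
      field_simp; linarith
    have h3' : peelC (j + 1) = peelC j * (2 * (2 * j + 1)) / (j + 2) := by
      field_simp; linarith
    rw [h2', h3']
    push_cast
    field_simp
    ring

lemma peel_sum (r : ℕ) :
    peelH (r + 1) / 6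
      + ∑ i ∈ Finset.range r, 2 * peelC i / (i + 2) * peelH (r - (i + 1)) = peelH r := by
  have := peel_partial r 0
  simp only [add_zero, Nat.cast_zero, mul_zero, zero_div, zero_mul] at this
  linarith

/-- The harmonic function. -/
noncomputable def peelG (m k : ℕ) : ℝ :=
  descFact (k : ℝ) (m + 1) / descFact ((k : ℝ) + 1 / 2) (m + 1)

lemma peelG_zero {m k : ℕ} (h : k ≤ m) : peelG m k = 0 := by
  unfold peelG descFact
  rw [Finset.prod_eq_zero (i := k) (by simp; omega) (by simp), zero_div]

lemma peelG_eq_prod (m k : ℕ) :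
    peelG m k = ∏ i ∈ Finset.range (m + 1), (((k : ℝ) - i) / ((k : ℝ) + 1 / 2 - i)) := by
  unfold peelG descFact
  rw [Finset.prod_div_distrib]

lemma peelG_pos {m k : ℕ} (h : m < k) : 0 < peelG m k := by
  rw [peelG_eq_prod]
  refine Finset.prod_pos fun i hi => ?_
  have : i < k := by simp at hi; omega
  have : (i : ℝ) < k := by exact_mod_cast this
  apply div_pos <;> linarith

lemma peelG_nonneg (m k : ℕ) : 0 ≤ peelG m k := by
  rcases le_or_gt k m with h | h
  · rw [peelG_zero h]
  · exact (peelG_pos h).le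

lemma peelG_le_one (m k : ℕ) : peelG m k ≤ 1 := by
  rcases le_or_gt k m with h | h
  · rw [peelG_zero h]; exact zero_le_one
  · rw [peelG_eq_prod]
    refine Finset.prod_le_one (fun i hi => ?_) (fun i hi => ?_)
    all_goals
      have : i < k := by simp at hi; omega
      have : (i : ℝ) < k := by exact_mod_cast this
    · apply div_nonneg <;> linarith
    · rw [div_le_one] <;> linarith

lemma peelG_tendsto (m : ℕ) : Tendsto (fun k => peelG m k) atTop (nhds 1) := by
  simp_rw [peelG_eq_prod]
  have hone : (1 : ℝ) = ∏ i ∈ Finset.range (m + 1), (1 : ℝ) := by simp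
  suffices this : ∀ i ∈ Finset.range (m + 1), Tendsto
      (fun k : ℕ => ((k : ℝ) - i) / ((k : ℝ) + 1 / 2 - i)) atTop (nhds 1) by
    have h := tendsto_finsetProd _ this
    rwa [← hone] at h
  intro i _
  have h1 : Tendsto (fun k : ℕ => (k : ℝ) + (1 / 2 - i)) atTop atTop :=
    tendsto_atTop_add_const_right _ _ tendsto_natCast_atTop_atTop
  have h2 := (tendsto_const_nhds (x := (1 : ℝ))).sub
    ((tendsto_const_nhds (x := (1 / 2 : ℝ))).div_atTop h1)
  rw [sub_zero] at h2
  refine h2.congr' ?_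
  filter_upwards [h1.eventually_gt_atTop 0] with k hk
  have : (k : ℝ) + 1 / 2 - i = k + (1 / 2 - i) := by ring
  rw [this, eq_div_iff hk.ne', sub_mul, div_mul_cancel₀ _ hk.ne']
  ring

lemma peel_desc (q r : ℕ) :
    peelH (r + q) * descFact ((r + q : ℕ) : ℝ) q
      = 4 ^ q * peelH r * descFact (((r + q : ℕ) : ℝ) + 1 / 2) q := by
  induction q generalizing r with
  | zero => simp [descFact]
  | succ q ih =>
    have h1 := ih (r + 1)
    have h2 := peelH_succ r
    unfold descFact at *
    rw [Finset.prod_range_succ, Finset.prod_range_succ]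
    rw [show r + 1 + q = r + (q + 1) by ring] at h1
    rw [← mul_assoc, h1]
    set D := ∏ i ∈ Finset.range q, (((r + (q + 1) : ℕ) : ℝ) + 1 / 2 - i)
    push_cast
    linear_combination 4 ^ q * D * h2

lemma peelHG (m r : ℕ) : peelH (r + (m + 1)) * peelG m (r + (m + 1)) = 4 ^ (m + 1) * peelH r := by
  have h := peel_desc (m + 1) r
  have hp : descFact (((r + (m + 1) : ℕ) : ℝ) + 1 / 2) (m + 1) ≠ 0 := by
    unfold descFact
    refine (Finset.prod_pos fun i hi => ?_).ne'
    have : i ≤ m := by simp at hi; omega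
    have : (i : ℝ) ≤ m := by exact_mod_cast this
    push_cast
    have : (0 : ℝ) ≤ r := by positivity
    linarith
  unfold peelG
  rw [← mul_div_assoc, h, mul_div_assoc, div_self hp, mul_one]

/-- expected next value -/
lemma peelG_step (m k : ℕ) :
    pMinusOne k * peelG m (k + 1) + ∑ i ∈ Finset.range k, pStep (i + 1) k * peelG m (k - (i + 1))
      = peelG m k + if k = m then pMinusOne m * peelG m (m + 1) else 0 := by
  rcases lt_trichotomy k m with h | h | h
  · rw [Finset.sum_eq_zero, peelG_zero (by omega), peelG_zero (by omega), if_neg (by omega)]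
    · simp
    · intro i _
      rw [peelG_zero (by omega), mul_zero]
  · subst h
    rw [Finset.sum_eq_zero, peelG_zero le_rfl, if_pos rfl]
    · simp
    · intro i _
      rw [peelG_zero (by omega), mul_zero]
  · obtain ⟨r, rfl⟩ : ∃ r, k = r + (m + 1) := ⟨k - (m + 1), by omega⟩
    rw [if_neg (by omega), add_zero]
    have hsub : Finset.range r ⊆ Finset.range (r + (m + 1)) := by
      intro i; simp; omega
    rw [← Finset.sum_subset hsub]
    swap
    · intro i _ hi
      rw [peelG_zero (by simp at hi; omega), mul_zero]
    have hpos := peelH_pos (r + (m + 1))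
    rw [← mul_right_inj' hpos.ne', mul_add, Finset.mul_sum, peelHG, ← peel_sum r, mul_add,
      Finset.mul_sum]
    congr 1
    · have := peelHG m (r + 1)
      rw [pMinusOne_eq]
      rw [show r + 1 + (m + 1) = r + (m + 1) + 1 by ring] at this
      field_simp
      linarith
    · refine Finset.sum_congr rfl fun i hi => ?_
      obtain ⟨s, rfl⟩ : ∃ s, r = i + 1 + s := ⟨r - (i + 1), by simp at hi; omega⟩
      have := peelHG m s
      rw [show i + 1 + s - (i + 1) = s by omega,
        show i + 1 + s + (m + 1) - (i + 1) = s + (m + 1) by omega,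
        show i + 1 + s + (m + 1) = i + 1 + (s + (m + 1)) by ring, pStep_eq]
      have h3 := peelH_pos (i + 1 + (s + (m + 1)))
      field_simp
      linear_combination peelC i * this

lemma pStep_nonneg (k m : ℕ) : 0 ≤ pStep k m := by unfold pStep; positivity

lemma pMinusOne_pos (m : ℕ) : 0 < pMinusOne m := by unfold pMinusOne; positivity

lemma peelTransition_nonneg (m k : ℕ) : 0 ≤ peelTransition m k := by
  unfold peelTransition
  split_ifs
  · exact (pMinusOne_pos m).le
  · exact pStep_nonneg _ _
  · exact le_rfl

lemma peel_kernel (m k : ℕ) :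
    ∑' j, ENNReal.ofReal (peelTransition k j) * ENNReal.ofReal (peelG m j)
      = ENNReal.ofReal (peelG m k)
        + ENNReal.ofReal (pMinusOne m * peelG m (m + 1)) * (if k = m then 1 else 0) := by
  have h1 : ∑' j, ENNReal.ofReal (peelTransition k j) * ENNReal.ofReal (peelG m j)
      = ENNReal.ofReal (∑ j ∈ Finset.range (k + 2), peelTransition k j * peelG m j) := by
    rw [tsum_eq_sum (s := Finset.range (k + 2)), ENNReal.ofReal_sum_of_nonneg]
    · exact Finset.sum_congr rfl fun j _ =>
        (ENNReal.ofReal_mul (peelTransition_nonneg _ _)).symm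
    · exact fun j _ => mul_nonneg (peelTransition_nonneg _ _) (peelG_nonneg _ _)
    · intro j hj
      have : k + 2 ≤ j := by simpa using hj
      rw [peelTransition, if_neg (by omega), if_neg (by omega)]
      simp
  have hd : 0 ≤ pMinusOne m * peelG m (m + 1) :=
    mul_nonneg (pMinusOne_pos m).le (peelG_nonneg _ _)
  have h2 : ∑ j ∈ Finset.range (k + 2), peelTransition k j * peelG m j
      = peelG m k + if k = m then pMinusOne m * peelG m (m + 1) else 0 := by
    rw [← peelG_step, Finset.sum_range_succ, Finset.sum_range_succ, add_comm]
    have e1 : peelTransition k (k + 1) = pMinusOne k := by simp [peelTransition]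
    have e2 : peelTransition k k = 0 := by simp [peelTransition]
    rw [e1, e2, zero_mul, add_zero]
    congr 1
    rw [← Finset.sum_range_reflect]
    refine Finset.sum_congr rfl fun i hi => ?_
    have hi : i < k := by simpa using hi
    rw [peelTransition, if_neg (by omega), if_pos (by omega),
      show k - (k - 1 - i) = i + 1 by omega, show k - 1 - i = k - (i + 1) by omega]
  rw [h1, h2, ENNReal.ofReal_add (peelG_nonneg _ _) (by split_ifs <;> simp [hd])]
  split_ifs <;> simp

lemma peel_markov {Ω : Type*} [MeasurableSpace Ω] (P : Measure Ω)
    [IsProbabilityMeasure P] (M : ℕ → Ω → ℕ) (hM : IsPeelingChain P M) (t : ℕ)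
    (c : (Fin (t + 1) → ℕ) → ENNReal) (φ : ℕ → ENNReal) :
    ∫⁻ ω, c (fun i => M i ω) * φ (M (t + 1) ω) ∂P
      = ∫⁻ ω, c (fun i => M i ω)
          * ∑' j, ENNReal.ofReal (peelTransition (M t ω) j) * φ j ∂P := by
  obtain ⟨hmeas, hstep⟩ := hM
  set Y : Ω → (Fin (t + 1) → ℕ) := fun ω i => M i ω with hY
  have hYm : Measurable Y := measurable_pi_lambda _ fun i => hmeas i
  have hZm : Measurable (fun ω => (Y ω, M (t + 1) ω)) := hYm.prodMk (hmeas _)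
  have e1 : ∫⁻ ω, c (Y ω) * φ (M (t + 1) ω) ∂P
      = ∫⁻ z : (Fin (t + 1) → ℕ) × ℕ, c z.1 * φ z.2 ∂(P.map (fun ω => (Y ω, M (t + 1) ω))) := by
    rw [lintegral_map (measurable_of_countable _) hZm]
  have e2 : ∫⁻ ω, c (Y ω) * ∑' j, ENNReal.ofReal (peelTransition (M t ω) j) * φ j ∂P
      = ∫⁻ s : (Fin (t + 1) → ℕ),
          c s * ∑' j, ENNReal.ofReal (peelTransition (s (Fin.last t)) j) * φ j ∂(P.map Y) := by
    rw [lintegral_map (measurable_of_countable _) hYm]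
    simp [hY]
  change ∫⁻ ω, c (Y ω) * φ (M (t + 1) ω) ∂P = ∫⁻ ω, c (Y ω) * _ ∂P
  rw [e1, e2, lintegral_countable', lintegral_countable', ENNReal.tsum_prod']
  refine tsum_congr fun s => ?_
  have key : ∀ j, (P.map (fun ω => (Y ω, M (t + 1) ω))) {(s, j)}
      = (P.map Y) {s} * ENNReal.ofReal (peelTransition (s (Fin.last t)) j) := by
    intro j
    rw [Measure.map_apply hZm (measurableSet_singleton _),
      Measure.map_apply hYm (measurableSet_singleton _)]
    let h : ℕ → ℕ := fun i => if hi : i < t + 1 then s ⟨i, hi⟩ else 0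
    have hA : Y ⁻¹' {s} = {ω | ∀ i ≤ t, M i ω = h i} := by
      ext ω
      simp only [Set.mem_preimage, Set.mem_singleton_iff, Set.mem_ofPred_eq, hY, funext_iff]
      constructor
      · intro H i hi
        simp only [h, dif_pos (Nat.lt_succ_of_le hi)]
        exact H ⟨i, Nat.lt_succ_of_le hi⟩
      · intro H i
        rw [H i (Nat.le_of_lt_succ i.2)]
        simp only [h, dif_pos i.2]
    have hB : (fun ω => (Y ω, M (t + 1) ω)) ⁻¹' {(s, j)}
        = Y ⁻¹' {s} ∩ {ω | M (t + 1) ω = j} := by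
      ext ω; simp
    have hlast : h t = s (Fin.last t) := by simp [h, Fin.last]
    rw [hB]
    have hAm : MeasurableSet (Y ⁻¹' {s}) := hYm (measurableSet_singleton _)
    by_cases h0 : P (Y ⁻¹' {s}) = 0
    · rw [h0, zero_mul]
      exact measure_mono_null Set.inter_subset_left h0
    · have := hstep t h (by rwa [← hA]) j
      rw [← hA, hlast] at this
      rw [← this, mul_comm, cond_mul_eq_inter hAm]
  simp_rw [key]
  rw [← ENNReal.tsum_mul_left, ← ENNReal.tsum_mul_right]
  refine tsum_congr fun j => ?_
  ring

lemma peel_transient {Ω : Type*} [MeasurableSpace Ω] (P : Measure Ω)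
    [IsProbabilityMeasure P] (M : ℕ → Ω → ℕ) (hM : IsPeelingChain P M) :
    ∀ᵐ ω ∂P, Tendsto (fun t => M t ω) atTop atTop := by
  have hmeas := hM.1
  have main : ∀ m : ℕ, ∀ᵐ ω ∂P, ∀ᶠ t in atTop, M t ω ≠ m := by
    intro m
    set d := ENNReal.ofReal (pMinusOne m * peelG m (m + 1)) with hd
    have hd0 : d ≠ 0 := by
      rw [hd, Ne, ENNReal.ofReal_eq_zero, not_le]
      exact mul_pos (pMinusOne_pos m) (peelG_pos (Nat.lt_succ_self m))
    have hms : ∀ t, MeasurableSet {ω | M t ω = m} := fun t =>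
      hmeas t (measurableSet_singleton m)
    have hstep : ∀ t, ∫⁻ ω, ENNReal.ofReal (peelG m (M (t + 1) ω)) ∂P
        = ∫⁻ ω, ENNReal.ofReal (peelG m (M t ω)) ∂P + d * P {ω | M t ω = m} := by
      intro t
      have := peel_markov P M hM t (fun _ => 1) (fun j => ENNReal.ofReal (peelG m j))
      simp only [one_mul, peel_kernel] at this
      rw [this, lintegral_add_left, lintegral_const_mul]
      · congr 2
        rw [← lintegral_indicator_one (hms t)]
        refine lintegral_congr fun ω => ?_
        simp [Set.indicator_apply]
      · exact (measurable_of_countable (fun k : ℕ => if k = m then (1 : ENNReal) else 0)).comp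
          (hmeas t)
      · exact (measurable_of_countable (fun k : ℕ => ENNReal.ofReal (peelG m k))).comp
          (hmeas t)
    have hsum : ∀ T, d * ∑ t ∈ Finset.range T, P {ω | M t ω = m} ≤ 1 := by
      intro T
      have : d * ∑ t ∈ Finset.range T, P {ω | M t ω = m}
          ≤ ∫⁻ ω, ENNReal.ofReal (peelG m (M T ω)) ∂P := by
        induction T with
        | zero => simp
        | succ T ih =>
          rw [Finset.sum_range_succ, mul_add, hstep]
          gcongr
      refine this.trans ?_
      calc ∫⁻ ω, ENNReal.ofReal (peelG m (M T ω)) ∂P ≤ ∫⁻ _, 1 ∂P :=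
            lintegral_mono fun ω => by simpa using peelG_le_one m (M T ω)
        _ = 1 := by simp
    have hts : ∑' t, P {ω | M t ω = m} ≠ ⊤ := by
      intro htop
      have h1 : d * ∑' t, P {ω | M t ω = m} ≤ 1 := by
        rw [ENNReal.tsum_eq_iSup_nat, ENNReal.mul_iSup]
        exact iSup_le hsum
      rw [htop, ENNReal.mul_top hd0] at h1
      exact absurd h1 (by simp)
    filter_upwards [ae_eventually_notMem hts] with ω hω
    exact hω
  filter_upwards [ae_all_iff.2 main] with ω hω
  rw [tendsto_atTop]
  intro b
  have : ∀ᶠ t in atTop, ∀ m ∈ Finset.range b, M t ω ≠ m :=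
    (Filter.eventually_all_finset _).2 fun m _ => hω m
  filter_upwards [this] with t ht
  by_contra hlt
  exact ht (M t ω) (by simpa using hlt) rfl

/-- For a peeling Markov chain started from `n` and `m < n`, the probability of ever
hitting `m` is `1 - (n)_{m+1}/(n+1/2)_{m+1}`. -/
theorem peeling_chain_hitting_prob {Ω : Type*} [MeasurableSpace Ω] (P : Measure Ω)
    [IsProbabilityMeasure P] (M : ℕ → Ω → ℕ) (hM : IsPeelingChain P M) (n m : ℕ)
    (hmn : m < n) (h0 : ∀ᵐ ω ∂P, M 0 ω = n) :
    P {ω | ∃ t : ℕ, M t ω = m} =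
      ENNReal.ofReal (1 - descFact (n : ℝ) (m + 1) / descFact ((n : ℝ) + 1 / 2) (m + 1)) := by
  classical
  have hmeas := hM.1
  change _ = ENNReal.ofReal (1 - peelG m n)
  have hms : ∀ t, MeasurableSet {ω | M t ω = m} := fun t =>
    hmeas t (measurableSet_singleton m)
  have hHit : MeasurableSet {ω | ∃ t : ℕ, M t ω = m} := by
    rw [Set.ofPred_exists]
    exact MeasurableSet.iUnion hms
  let c : (t : ℕ) → (Fin (t + 1) → ℕ) → ENNReal := fun t s => if ∀ i, s i ≠ m then 1 else 0
  let X : ℕ → Ω → ENNReal := fun t ω =>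
    c t (fun i => M i ω) * ENNReal.ofReal (peelG m (M t ω))
  have hY : ∀ t, Measurable (fun ω => (fun i : Fin (t + 1) => M i ω)) := fun t =>
    measurable_pi_lambda _ fun i => hmeas i
  have hX : ∀ t, Measurable (X t) := fun t =>
    ((measurable_of_countable (c t)).comp (hY t)).mul
      ((measurable_of_countable (fun k : ℕ => ENNReal.ofReal (peelG m k))).comp (hmeas t))
  have hconst : ∀ t, ∫⁻ ω, X t ω ∂P = ENNReal.ofReal (peelG m n) := by
    intro t
    induction t with
    | zero =>
      have : ∫⁻ ω, X 0 ω ∂P = ∫⁻ _, ENNReal.ofReal (peelG m n) ∂P := by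
        refine lintegral_congr_ae ?_
        filter_upwards [h0] with ω hω
        have : n ≠ m := by omega
        simp [X, c, hω, this]
      rw [this]
      simp
    | succ t ih =>
      rw [← ih]
      have h1 := peel_markov P M hM t (c t) (fun j => ENNReal.ofReal (peelG m j))
      simp only [peel_kernel] at h1
      refine Eq.trans ?_ (h1.trans ?_)
      · refine lintegral_congr fun ω => ?_
        simp only [X]
        by_cases hm : M (t + 1) ω = m
        · simp [hm, peelG_zero le_rfl]
        · congr 1
          simp only [c]
          refine if_congr ?_ rfl rfl
          constructor
          · intro H i
            exact H i.castSucc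
          · intro H i
            refine Fin.lastCases ?_ (fun i => ?_) i
            · simpa using hm
            · exact H i
      · refine lintegral_congr fun ω => ?_
        simp only [X, c]
        split_ifs with hA hB
        · exact absurd (by simpa using hB) (hA (Fin.last t))
        · simp
        · simp
        · simp
  have hlim : Tendsto (fun t => ∫⁻ ω, X t ω ∂P) atTop
      (nhds (∫⁻ ω, ({ω | ∃ t : ℕ, M t ω = m}ᶜ).indicator 1 ω ∂P)) := by
    refine tendsto_lintegral_of_dominated_convergence (fun _ => 1) hX ?_ (by simp) ?_
    · intro t
      refine Eventually.of_forall fun ω => ?_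
      simp only [X]
      refine mul_le_one' ?_ (by simpa using peelG_le_one m _)
      simp only [c]
      split_ifs <;> simp
    · filter_upwards [peel_transient P M hM] with ω hω
      by_cases hh : ∃ t, M t ω = m
      · have : ω ∉ {ω | ∃ t : ℕ, M t ω = m}ᶜ := by simpa using hh
        rw [Set.indicator_of_notMem this]
        obtain ⟨t0, ht0⟩ := hh
        refine tendsto_const_nhds.congr' ?_
        filter_upwards [eventually_ge_atTop t0] with t ht
        simp only [X, c]
        rw [if_neg, zero_mul]
        intro H
        exact H ⟨t0, by omega⟩ ht0
      · have : ω ∈ {ω | ∃ t : ℕ, M t ω = m}ᶜ := by simpa using hh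
        rw [Set.indicator_of_mem this]
        have h2 := ENNReal.tendsto_ofReal ((peelG_tendsto m).comp hω)
        rw [ENNReal.ofReal_one] at h2
        refine h2.congr fun t => ?_
        simp only [X, c]
        rw [if_pos, one_mul]
        · rfl
        · intro i hi
          exact hh ⟨i, hi⟩
  rw [lintegral_indicator_one hHit.compl] at hlim
  simp_rw [hconst] at hlim
  have hno := tendsto_nhds_unique hlim tendsto_const_nhds
  rw [← compl_compl {ω | ∃ t : ℕ, M t ω = m}, prob_compl_eq_one_sub hHit.compl, hno,
    ENNReal.ofReal_sub _ (peelG_nonneg _ _), ENNReal.ofReal_one]
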